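/- Let α be an action of a countable group Γ by homeomorphisms on a nonempty compact Hausdorff 0-dimensional space X. Then α has dynamical comparison if and only if for all nonzero a, b ∈ T(α) such that μ(a) < μ(b) for every μ ∈ M(α), one has a ≤ b. -/

import Mathlib

open MeasureTheory Set
open scoped ENNReal

/-! Preliminary definitions: the clopen type semigroup of an action of a group `Γ`
by homeomorphisms on a topological space `X`, invariant measures, dynamical comparison,
topological full groups, and the topology on spaces of actions. -/

/-- The group of self-homeomorphisms of `X`, with `(g * h) x = g (h x)`. -/
instance homeoGroup (X : Type*) [TopologicalSpace X] : Group (X ≃ₜ X) where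
  mul g h := h.trans g
  one := Homeomorph.refl X
  inv := Homeomorph.symm
  mul_assoc a b c := Homeomorph.ext fun _ => rfl
  one_mul a := Homeomorph.ext fun _ => rfl
  mul_one a := Homeomorph.ext fun _ => rfl
  inv_mul_cancel a := Homeomorph.ext fun x => a.symm_apply_apply x

/-- The Cantor space `{0,1}^ℕ`. -/
abbrev Cantor : Type := ℕ → Bool

section Defs

variable {Γ : Type*} [Group Γ] {X : Type*} [TopologicalSpace X]

/-- A left-invariant finitely additive probability measure on (the power set of) `Γ`,
with values in `[0,1]`. `Γ` is amenable iff such a measure exists. -/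
def IsInvFapm {Γ : Type*} [Group Γ] (m : Set Γ → ℝ) : Prop :=
  (∀ E : Set Γ, 0 ≤ m E) ∧ (∀ E : Set Γ, m E ≤ 1) ∧ m Set.univ = 1 ∧
  (∀ E F : Set Γ, Disjoint E F → m (E ∪ F) = m E + m F) ∧
  (∀ (γ : Γ) (E : Set Γ), m ((γ * ·) '' E) = m E)

/-- The action of `γ ∈ Γ` on continuous `ℕ`-valued functions: `(γ · f)(x) = f(γ⁻¹ · x)`. -/
def actC (α : Γ →* X ≃ₜ X) (γ : Γ) (f : C(X, ℕ)) : C(X, ℕ) :=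
  f.comp (α γ⁻¹)

/-- The equidecomposability relation `∼` on `C(X, ℕ)`: `f ∼ g` iff `f = h₁ + ⋯ + hₙ`
and `g = γ₁·h₁ + ⋯ + γₙ·hₙ` for some `hᵢ ∈ C(X,ℕ)`, `γᵢ ∈ Γ`. -/
def TypeRel (α : Γ →* X ≃ₜ X) (f g : C(X, ℕ)) : Prop :=
  ∃ (n : ℕ) (h : Fin n → C(X, ℕ)) (γ : Fin n → Γ),
    f = ∑ i, h i ∧ g = ∑ i, actC α (γ i) (h i)

/-- The additive congruence on `C(X, ℕ)` generated by `∼` (since `∼` is itself an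
additive congruence, this is just `∼`). -/
def typeCon (α : Γ →* X ≃ₜ X) : AddCon C(X, ℕ) := addConGen (TypeRel α)

/-- The clopen type semigroup `T(α) = C(X,ℕ)/∼`. -/
abbrev TypeSemigroup (α : Γ →* X ≃ₜ X) := (typeCon α).Quotient

/-- The class `[f] ∈ T(α)` of `f ∈ C(X, ℕ)`. -/
def cls (α : Γ →* X ≃ₜ X) (f : C(X, ℕ)) : TypeSemigroup α := (typeCon α).toQuotient f

/-- The algebraic preorder on `T(α)`: `a ≤ b` iff `a + c = b` for some `c`. -/
def tle (α : Γ →* X ≃ₜ X) (a b : TypeSemigroup α) : Prop := ∃ c, a + c = b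

/-- `T(α)` is unperforated: `n • a ≤ n • b` implies `a ≤ b` for all `n ≥ 1`. -/
def IsUnperforated (α : Γ →* X ≃ₜ X) : Prop :=
  ∀ (a b : TypeSemigroup α) (n : ℕ), 1 ≤ n → tle α (n • a) (n • b) → tle α a b

/-- `T(α)` is almost unperforated: `(n+1) • a ≤ n • b` implies `a ≤ b`. -/
def IsAlmostUnperforated (α : Γ →* X ≃ₜ X) : Prop :=
  ∀ (a b : TypeSemigroup α) (n : ℕ), tle α ((n + 1) • a) (n • b) → tle α a b

/-- `T(α)` is cancellative: `a + b = a + c` implies `b = c`. -/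
def IsCancellative (α : Γ →* X ≃ₜ X) : Prop :=
  ∀ a b c : TypeSemigroup α, a + b = a + c → b = c

/-- The algebraic preorder on `T(α)` is a partial order, i.e. it is antisymmetric. -/
def TleAntisymm (α : Γ →* X ≃ₜ X) : Prop :=
  ∀ a b : TypeSemigroup α, tle α a b → tle α b a → a = b

/-- `b` is an order unit of `T(α)`: every `a` satisfies `a ≤ k • b` for some `k ∈ ℕ`. -/
def IsOrderUnit (α : Γ →* X ≃ₜ X) (b : TypeSemigroup α) : Prop :=
  ∀ a : TypeSemigroup α, ∃ k : ℕ, tle α a (k • b)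

/-- A state on `T(α)`: an additive map to `[0,∞]` sending `0` to `0`. -/
def IsState (α : Γ →* X ≃ₜ X) (ν : TypeSemigroup α → ℝ≥0∞) : Prop :=
  ν 0 = 0 ∧ ∀ a b : TypeSemigroup α, ν (a + b) = ν a + ν b

/-- `M(α)`: the set of `Γ`-invariant Radon (regular Borel) probability measures on `X`. -/
def invRadon (α : Γ →* X ≃ₜ X) : Set (@Measure X (borel X)) :=
  letI : MeasurableSpace X := borel X
  {μ : Measure X | IsProbabilityMeasure μ ∧ μ.Regular ∧ ∀ γ : Γ, Measure.map ⇑(α γ) μ = μ}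

/-- The set of `Γ`-invariant Borel probability measures on `X`. -/
def invBorel (α : Γ →* X ≃ₜ X) : Set (@Measure X (borel X)) :=
  letI : MeasurableSpace X := borel X
  {μ : Measure X | IsProbabilityMeasure μ ∧ ∀ γ : Γ, Measure.map ⇑(α γ) μ = μ}

/-- `μ([f]) = ∫ f dμ`, the value of (the state associated with) a measure on the class of
`f ∈ C(X, ℕ)`. -/
noncomputable def intOf {X : Type*} [TopologicalSpace X] (μ : @Measure X (borel X))
    (f : C(X, ℕ)) : ℝ :=
  letI : MeasurableSpace X := borel X
  ∫ x, (f x : ℝ) ∂μ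

/-- `A` is subequidecomposable to `B`: there are a partition `A = A₁ ⊔ ⋯ ⊔ Aₙ` into clopen
sets and `γ₁, …, γₙ ∈ Γ` with `γ₁A₁, …, γₙAₙ` pairwise disjoint and contained in `B`. -/
def Subequidecomposable (α : Γ →* X ≃ₜ X) (A B : Set X) : Prop :=
  ∃ (n : ℕ) (P : Fin n → Set X) (γ : Fin n → Γ),
    (∀ i, IsClopen (P i)) ∧ (Pairwise fun i j => Disjoint (P i) (P j)) ∧
    (⋃ i, P i) = A ∧
    (Pairwise fun i j => Disjoint (⇑(α (γ i)) '' P i) (⇑(α (γ j)) '' P j)) ∧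
    ∀ i, ⇑(α (γ i)) '' P i ⊆ B

/-- Dynamical comparison (with respect to invariant Radon probability measures): for all
clopen `A`, `B` with `B` nonempty and `μ(A) < μ(B)` for every `μ ∈ M(α)`, `A` is
subequidecomposable to `B`. -/
def DynComparison (α : Γ →* X ≃ₜ X) : Prop :=
  ∀ A B : Set X, IsClopen A → IsClopen B → B.Nonempty →
    (∀ μ ∈ invRadon α, μ A < μ B) → Subequidecomposable α A B

/-- Dynamical comparison (with respect to invariant Borel probability measures). -/
def DynComparisonBorel (α : Γ →* X ≃ₜ X) : Prop :=
  ∀ A B : Set X, IsClopen A → IsClopen B → B.Nonempty →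
    (∀ μ ∈ invBorel α, μ A < μ B) → Subequidecomposable α A B

/-- The action `α` is minimal: the only closed invariant subsets are `∅` and `X`. -/
def IsMinimalAction (α : Γ →* X ≃ₜ X) : Prop :=
  ∀ F : Set X, IsClosed F → (∀ γ : Γ, ⇑(α γ) '' F ⊆ F) → F = ∅ ∨ F = Set.univ

/-- Membership in the topological full group `⟦α⟧`: `g` coincides with elements of the
action on the pieces of a finite clopen partition of `X`. -/
def InTopFullGroup (α : Γ →* X ≃ₜ X) (g : X ≃ₜ X) : Prop :=
  ∃ (n : ℕ) (P : Fin n → Set X) (γ : Fin n → Γ),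
    (∀ i, IsClopen (P i)) ∧ (Pairwise fun i j => Disjoint (P i) (P j)) ∧
    (⋃ i, P i) = Set.univ ∧ ∀ i, ∀ x ∈ P i, g x = α (γ i) x

/-- `⟦α⟧` admits a dense locally finite subgroup: there is a subgroup `Λ` of `Homeo(X)`
contained in `⟦α⟧`, locally finite (all its finitely generated subgroups are finite), and
dense in `⟦α⟧` for the topology whose basic neighborhoods of `h` are
`{g : g A = h A for all A ∈ 𝒜}`, `𝒜` ranging over finite clopen partitions of `X`. -/
def HasDenseLocallyFiniteSubgroup (α : Γ →* X ≃ₜ X) : Prop :=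
  ∃ Λ : Subgroup (X ≃ₜ X),
    ((Λ : Set (X ≃ₜ X)) ⊆ {g | InTopFullGroup α g}) ∧
    (∀ s : Finset (X ≃ₜ X), (s : Set (X ≃ₜ X)) ⊆ (Λ : Set (X ≃ₜ X)) →
      ((Subgroup.closure (s : Set (X ≃ₜ X)) : Subgroup (X ≃ₜ X)) : Set (X ≃ₜ X)).Finite) ∧
    ∀ g : X ≃ₜ X, InTopFullGroup α g →
      ∀ (n : ℕ) (P : Fin n → Set X), (∀ i, IsClopen (P i)) →
        (Pairwise fun i j => Disjoint (P i) (P j)) → (⋃ i, P i) = Set.univ →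
        ∃ l ∈ Λ, ∀ i, ⇑l '' P i = ⇑g '' P i

end Defs

/-- The topology on `Homeo(X)` whose basic neighborhoods of `h` are the sets
`{g : g A = h A for all A ∈ 𝒜}`, for `𝒜` a finite clopen partition of `X`; equivalently,
the topology generated by the sets `{g : g '' A = B}` for `A`, `B` clopen. -/
def homeoTop (X : Type*) [TopologicalSpace X] : TopologicalSpace (X ≃ₜ X) :=
  TopologicalSpace.generateFrom
    {U | ∃ A B : Set X, IsClopen A ∧ IsClopen B ∧ U = {g : X ≃ₜ X | ⇑g '' A = B}}

/-- The topology on the space `A(Γ)` of actions of `Γ` on `X`, induced from the product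
topology on `Homeo(X)^Γ`. -/
def actionTop (Γ : Type*) [Group Γ] (X : Type*) [TopologicalSpace X] :
    TopologicalSpace (Γ →* (X ≃ₜ X)) :=
  letI := homeoTop X
  TopologicalSpace.induced (fun φ : Γ →* (X ≃ₜ X) => ⇑φ) Pi.topologicalSpace

section Aux

variable {Γ : Type*} [Group Γ] {X : Type*} [TopologicalSpace X]

/-- truncated subtraction -/
def csub (f g : C(X, ℕ)) : C(X, ℕ) :=
  ⟨fun x => f x - g x, (continuous_of_discreteTopology (f := fun p : ℕ × ℕ => p.1 - p.2)).comp
    (f.continuous.prodMk g.continuous)⟩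

def cmin (f g : C(X, ℕ)) : C(X, ℕ) :=
  ⟨fun x => min (f x) (g x), (continuous_of_discreteTopology (f := fun p : ℕ × ℕ => min p.1 p.2)).comp
    (f.continuous.prodMk g.continuous)⟩

@[simp] lemma csub_apply (f g : C(X, ℕ)) (x : X) : csub f g x = f x - g x := rfl
@[simp] lemma cmin_apply (f g : C(X, ℕ)) (x : X) : cmin f g x = min (f x) (g x) := rfl

@[simp] lemma actC_apply (α : Γ →* X ≃ₜ X) (γ : Γ) (f : C(X, ℕ)) (x : X) :
    actC α γ f x = f (α γ⁻¹ x) := rfl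

lemma act_mul (α : Γ →* X ≃ₜ X) (a b : Γ) (x : X) : α (a * b) x = α a (α b x) := by
  rw [map_mul]; rfl

lemma act_one (α : Γ →* X ≃ₜ X) (x : X) : α 1 x = x := by
  rw [map_one]; rfl

@[simp] lemma act_inv_act (α : Γ →* X ≃ₜ X) (a : Γ) (x : X) : α a⁻¹ (α a x) = x := by
  rw [← act_mul]; simp [act_one]

@[simp] lemma act_act_inv (α : Γ →* X ≃ₜ X) (a : Γ) (x : X) : α a (α a⁻¹ x) = x := by
  rw [← act_mul]; simp [act_one]

lemma actC_actC (α : Γ →* X ≃ₜ X) (a b : Γ) (f : C(X, ℕ)) :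
    actC α a (actC α b f) = actC α (a * b) f := by
  ext x; simp [act_mul]

lemma actC_one (α : Γ →* X ≃ₜ X) (f : C(X, ℕ)) : actC α 1 f = f := by
  ext x; simp [act_one]

lemma actC_sum (α : Γ →* X ≃ₜ X) (a : Γ) {ι : Type*} (s : Finset ι) (f : ι → C(X, ℕ)) :
    actC α a (∑ i ∈ s, f i) = ∑ i ∈ s, actC α a (f i) := by
  ext x; simp [ContinuousMap.sum_apply]

lemma typeRel_of_fintype (α : Γ →* X ≃ₜ X) {ι : Type*} [Fintype ι] (h : ι → C(X, ℕ)) (γ : ι → Γ) :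
    TypeRel α (∑ i, h i) (∑ i, actC α (γ i) (h i)) := by
  classical
  let e := Fintype.equivFin ι
  refine ⟨Fintype.card ι, h ∘ e.symm, γ ∘ e.symm, ?_, ?_⟩
  · exact (Equiv.sum_comp e.symm h).symm
  · exact (Equiv.sum_comp e.symm (fun i => actC α (γ i) (h i))).symm

lemma riesz_dec (m : ℕ) : ∀ (v : Fin m → C(X, ℕ)) (u : C(X, ℕ)), (∀ x, u x ≤ (∑ j, v j) x) →
    ∃ w r : Fin m → C(X, ℕ), u = ∑ j, w j ∧ ∀ j, v j = w j + r j := by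
  induction m with
  | zero =>
    intro v u h
    refine ⟨v, v, ?_, fun j => j.elim0⟩
    ext x; have := h x; simp at this ⊢; exact this
  | succ m ih =>
    intro v u h
    obtain ⟨w, r, h1, h2⟩ := ih (fun j => v j.succ) (csub u (v 0)) (by
      intro x
      have := h x
      rw [Fin.sum_univ_succ] at this
      simp only [ContinuousMap.add_apply] at this
      simp only [csub_apply]; omega)
    refine ⟨Fin.cons (cmin u (v 0)) w, Fin.cons (csub (v 0) u) r, ?_, ?_⟩
    · rw [Fin.sum_univ_succ]
      simp only [Fin.cons_zero, Fin.cons_succ]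
      rw [← h1]
      ext x; simp only [ContinuousMap.add_apply, csub_apply, cmin_apply]; omega
    · intro j
      refine Fin.cases ?_ (fun j => ?_) j
      · ext x; simp only [ContinuousMap.add_apply, csub_apply, cmin_apply, Fin.cons_zero]; omega
      · simpa using h2 j

lemma riesz_ref (n : ℕ) : ∀ (m : ℕ) (u : Fin n → C(X, ℕ)) (v : Fin m → C(X, ℕ)),
    ∑ i, u i = ∑ j, v j →
    ∃ w : Fin n → Fin m → C(X, ℕ), (∀ i, u i = ∑ j, w i j) ∧ ∀ j, v j = ∑ i, w i j := by
  induction n with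
  | zero =>
    intro m u v h
    refine ⟨fun i => i.elim0, fun i => i.elim0, fun j => ?_⟩
    simp only [Finset.univ_eq_empty, Finset.sum_empty] at h ⊢
    ext x
    have hx := congrArg (fun f : C(X, ℕ) => f x) h
    simp only [ContinuousMap.sum_apply, ContinuousMap.zero_apply] at hx ⊢
    exact (Finset.sum_eq_zero_iff.1 hx.symm) j (Finset.mem_univ _)
  | succ n ih =>
    intro m u v h
    obtain ⟨w, r, h1, h2⟩ := riesz_dec m v (u 0) (by
      intro x; rw [← h, Fin.sum_univ_succ]; simp)
    obtain ⟨w', h3, h4⟩ := ih m (fun i => u i.succ) r (by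
      have : u 0 + ∑ i : Fin n, u i.succ = u 0 + ∑ j, r j := by
        rw [← Fin.sum_univ_succ, h, h1, ← Finset.sum_add_distrib]
        exact Finset.sum_congr rfl fun j _ => h2 j
      ext x
      have hx := congrArg (fun f : C(X, ℕ) => f x) this
      simpa using hx)
    refine ⟨Fin.cons w w', ?_, ?_⟩
    · intro i
      refine Fin.cases ?_ (fun i => ?_) i
      · simpa using h1
      · simpa using h3 i
    · intro j
      rw [Fin.sum_univ_succ]
      simp only [Fin.cons_zero, Fin.cons_succ]
      rw [← h4, h2]

def typeCon' (α : Γ →* X ≃ₜ X) : AddCon C(X, ℕ) where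
  r := TypeRel α
  iseqv := by
    refine ⟨?_, ?_, ?_⟩
    · intro f
      refine ⟨1, fun _ => f, fun _ => 1, by simp, by simp [actC_one]⟩
    · rintro f g ⟨n, h, γ, rfl, rfl⟩
      refine ⟨n, fun i => actC α (γ i) (h i), fun i => (γ i)⁻¹, rfl, ?_⟩
      simp [actC_actC, actC_one]
    · rintro f g k ⟨n, h, γ, rfl, rfl⟩ ⟨m, h', γ', e, rfl⟩
      obtain ⟨w, h1, h2⟩ := riesz_ref n m _ _ e
      have key := typeRel_of_fintype α (fun p : Fin n × Fin m => actC α (γ p.1)⁻¹ (w p.1 p.2))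
        (fun p => γ' p.2 * γ p.1)
      convert key using 1
      · rw [Fintype.sum_prod_type]
        refine Finset.sum_congr rfl fun i _ => ?_
        simp only
        rw [← actC_sum, ← h1, actC_actC]; simp [actC_one]
      · rw [Fintype.sum_prod_type_right]
        refine Finset.sum_congr rfl fun j _ => ?_
        simp only [actC_actC, mul_assoc, mul_inv_cancel, mul_one]
        rw [← actC_sum, ← h2]
  add' := by
    rintro _ _ _ _ ⟨n, h, γ, rfl, rfl⟩ ⟨m, h', γ', rfl, rfl⟩
    have key := typeRel_of_fintype α (Sum.elim h h') (Sum.elim γ γ')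
    simpa using key

lemma cls_eq_iff (α : Γ →* X ≃ₜ X) (f g : C(X, ℕ)) : cls α f = cls α g ↔ TypeRel α f g := by
  have h : typeCon α = typeCon' α := by
    apply le_antisymm
    · exact AddCon.addConGen_le.2 fun x y h => h
    · intro x y h
      exact AddConGen.Rel.of _ _ h
  unfold cls
  rw [show ((typeCon α).toQuotient f = (typeCon α).toQuotient g ↔ TypeRel α f g) ↔
    (typeCon α f g ↔ TypeRel α f g) from by rw [← AddCon.eq], h]
  rfl

lemma cls_add (α : Γ →* X ≃ₜ X) (f g : C(X, ℕ)) : cls α (f + g) = cls α f + cls α g := rfl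
lemma cls_zero (α : Γ →* X ≃ₜ X) : cls α 0 = 0 := rfl
lemma cls_surj (α : Γ →* X ≃ₜ X) (a : TypeSemigroup α) : ∃ f, cls α f = a :=
  Quotient.exists_rep a

lemma cls_ne_zero (α : Γ →* X ≃ₜ X) (f : C(X, ℕ)) (hf : f ≠ 0) : cls α f ≠ 0 := by
  rw [← cls_zero, Ne, cls_eq_iff]
  rintro ⟨n, h, γ, rfl, h2⟩
  apply hf
  refine Finset.sum_eq_zero fun i _ => ?_
  ext x
  have hx := congrArg (fun f : C(X, ℕ) => f (α (γ i) x)) h2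
  simp only [ContinuousMap.sum_apply, ContinuousMap.zero_apply] at hx
  have := (Finset.sum_eq_zero_iff.1 hx.symm) i (Finset.mem_univ _)
  simpa using this

lemma cls_actC (α : Γ →* X ≃ₜ X) (γ : Γ) (f : C(X, ℕ)) : cls α (actC α γ f) = cls α f := by
  symm
  rw [cls_eq_iff]
  exact ⟨1, fun _ => f, fun _ => γ, by simp, by simp⟩

lemma tle_refl (α : Γ →* X ≃ₜ X) (a : TypeSemigroup α) : tle α a a := ⟨0, add_zero a⟩

lemma tle_trans {α : Γ →* X ≃ₜ X} {a b c : TypeSemigroup α} (h : tle α a b) (h' : tle α b c) :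
    tle α a c := by
  obtain ⟨d, rfl⟩ := h
  obtain ⟨e, rfl⟩ := h'
  exact ⟨d + e, (add_assoc _ _ _).symm⟩

lemma tle_add {α : Γ →* X ≃ₜ X} {a b c d : TypeSemigroup α} (h : tle α a b) (h' : tle α c d) :
    tle α (a + c) (b + d) := by
  obtain ⟨e, rfl⟩ := h
  obtain ⟨e', rfl⟩ := h'
  exact ⟨e + e', by rw [add_add_add_comm]⟩

lemma tle_nsmul {α : Γ →* X ≃ₜ X} {a b : TypeSemigroup α} (h : tle α a b) (n : ℕ) :
    tle α (n • a) (n • b) := by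
  obtain ⟨e, rfl⟩ := h
  exact ⟨n • e, by rw [nsmul_add]⟩

lemma tle_of_le {α : Γ →* X ≃ₜ X} {f g : C(X, ℕ)} (h : ∀ x, f x ≤ g x) :
    tle α (cls α f) (cls α g) := by
  refine ⟨cls α (csub g f), ?_⟩
  rw [← cls_add]
  congr 1
  ext x; have := h x; simp; omega

lemma cls_nsmul (α : Γ →* X ≃ₜ X) (n : ℕ) (f : C(X, ℕ)) : cls α (n • f) = n • cls α f := rfl

open Classical in
/-- indicator of a clopen set -/
noncomputable def indC (A : Set X) (hA : IsClopen A) : C(X, ℕ) :=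
  ⟨A.indicator (fun _ => 1), hA.continuous_indicator continuous_const⟩

open Classical in
lemma indC_apply (A : Set X) (hA : IsClopen A) (x : X) :
    indC A hA x = if x ∈ A then 1 else 0 := by
  simp [indC, Set.indicator_apply]

lemma act_image (α : Γ →* X ≃ₜ X) (γ : Γ) (A : Set X) : α γ '' A = {x | α γ⁻¹ x ∈ A} := by
  ext x
  constructor
  · rintro ⟨y, hy, rfl⟩; simpa using hy
  · intro h; exact ⟨_, h, by simp⟩

lemma sum_indC {n : ℕ} (P : Fin n → Set X) (hP : ∀ i, IsClopen (P i))
    (hd : Pairwise fun i j => Disjoint (P i) (P j)) (A : Set X) (hA : IsClopen A)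
    (hU : ⋃ i, P i = A) : indC A hA = ∑ i, indC (P i) (hP i) := by
  classical
  ext x
  rw [ContinuousMap.sum_apply]
  simp only [indC_apply]
  by_cases hx : x ∈ A
  · rw [if_pos hx]
    obtain ⟨i, hi⟩ := Set.mem_iUnion.1 (hU ▸ hx)
    rw [Finset.sum_eq_single i, if_pos hi]
    · intro j _ hji
      rw [if_neg]
      intro hj
      exact Set.disjoint_left.1 (hd hji) hj hi
    · simp
  · rw [if_neg hx, Finset.sum_eq_zero]
    intro i _
    rw [if_neg]
    intro hi
    exact hx (hU ▸ Set.mem_iUnion.2 ⟨i, hi⟩)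

lemma subeq_copy {α : Γ →* X ≃ₜ X} {A B : Set X} (hA : IsClopen A)
    (h : Subequidecomposable α A B) :
    ∃ C, ∃ hC : IsClopen C, C ⊆ B ∧ TypeRel α (indC A hA) (indC C hC) := by
  obtain ⟨n, P, γ, h1, h2, h3, h4, h5⟩ := h
  have hcl : ∀ i, IsClopen (α (γ i) '' P i) := fun i =>
    ⟨(α (γ i)).isClosedMap _ (h1 i).1, (α (γ i)).isOpenMap _ (h1 i).2⟩
  refine ⟨⋃ i, α (γ i) '' P i, isClopen_iUnion_of_finite hcl, Set.iUnion_subset h5, ?_⟩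
  refine ⟨n, fun i => indC (P i) (h1 i), γ, sum_indC P h1 h2 A hA h3, ?_⟩
  rw [sum_indC _ hcl h4 _ _ rfl]
  refine Finset.sum_congr rfl fun i _ => ?_
  classical
  ext x
  simp only [indC_apply, actC_apply, act_image, Set.mem_ofPred_eq]

lemma subeq_of_tle {α : Γ →* X ≃ₜ X} {A B : Set X} (hA : IsClopen A) (hB : IsClopen B)
    (h : tle α (cls α (indC A hA)) (cls α (indC B hB))) : Subequidecomposable α A B := by
  classical
  obtain ⟨c, hc⟩ := h
  obtain ⟨k, rfl⟩ := cls_surj α c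
  rw [← cls_add, cls_eq_iff] at hc
  obtain ⟨n, h, γ, e1, e2⟩ := hc
  have hcl : ∀ i, IsClopen {x | h i x ≠ 0} := fun i =>
    (isClopen_discrete {m : ℕ | m ≠ 0}).preimage (h i).continuous
  have e1' : ∀ x ∈ A, ∃ i, h i x ≠ 0 := by
    intro x hx
    by_contra hcon
    push Not at hcon
    have := congrArg (fun f : C(X, ℕ) => f x) e1
    simp [ContinuousMap.sum_apply, hcon, indC_apply, hx] at this
  have e2' : ∀ i x, h i x ≠ 0 → α (γ i) x ∈ B := by
    intro i x hx
    by_contra hcon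
    have := congrArg (fun f : C(X, ℕ) => f (α (γ i) x)) e2
    simp only [ContinuousMap.sum_apply, indC_apply, if_neg hcon] at this
    have := (Finset.sum_eq_zero_iff.1 this.symm) i (Finset.mem_univ _)
    simp at this
    exact hx this
  have e3' : ∀ i j x y, i ≠ j → h i x ≠ 0 → h j y ≠ 0 → α (γ i) x ≠ α (γ j) y := by
    intro i j x y hij hi hj hxy
    have := congrArg (fun f : C(X, ℕ) => f (α (γ i) x)) e2
    have hle : indC B hB (α (γ i) x) ≤ 1 := by rw [indC_apply]; split_ifs <;> simp
    simp only [ContinuousMap.sum_apply] at this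
    rw [this] at hle
    have h2 : ∑ l ∈ {i, j}, (actC α (γ l) (h l)) (α (γ i) x) ≤ 1 :=
      (Finset.sum_le_sum_of_subset (Finset.subset_univ _)).trans hle
    rw [Finset.sum_pair hij] at h2
    simp only [actC_apply, act_inv_act] at h2
    rw [hxy, act_inv_act] at h2
    omega
  refine ⟨n, fun i => A ∩ ({x | h i x ≠ 0} \ ⋃ j : Set.Iio i, {x | h j x ≠ 0}), γ, ?_, ?_, ?_, ?_, ?_⟩
  · intro i
    exact hA.inter ((hcl i).diff (isClopen_iUnion_of_finite fun j => hcl j))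
  · have key : ∀ i j : Fin n, i < j → Disjoint
        (A ∩ ({x | h i x ≠ 0} \ ⋃ j : Set.Iio i, {x | h j x ≠ 0}))
        (A ∩ ({x | h j x ≠ 0} \ ⋃ l : Set.Iio j, {x | h l x ≠ 0})) := by
      intro i j hij
      rw [Set.disjoint_left]
      rintro x ⟨_, hx, _⟩ ⟨_, _, hx'⟩
      exact hx' (Set.mem_iUnion.2 ⟨⟨i, hij⟩, hx⟩)
    intro i j hij
    rcases lt_or_gt_of_ne hij with h | h
    · exact key i j h
    · exact (key j i h).symm
  · ext x
    constructor
    · intro hx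
      obtain ⟨i, hi⟩ := Set.mem_iUnion.1 hx
      exact hi.1
    · intro hx
      have hne : (Finset.univ.filter fun i => h i x ≠ 0).Nonempty := by
        obtain ⟨i, hi⟩ := e1' x hx
        exact ⟨i, by simpa using hi⟩
      refine Set.mem_iUnion.2 ⟨Finset.min' _ hne, hx, ?_, ?_⟩
      · have := Finset.min'_mem _ hne
        simpa using this
      · intro hx'
        obtain ⟨⟨j, hj⟩, hj'⟩ := Set.mem_iUnion.1 hx'
        have := Finset.min'_le (Finset.univ.filter fun i => h i x ≠ 0) j (by simpa using hj')
        exact absurd hj (not_lt.2 this)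
  · intro i j hij
    rw [Set.disjoint_left]
    rintro z ⟨x, hx, rfl⟩ ⟨y, hy, hxy⟩
    exact e3' i j x y hij hx.2.1 hy.2.1 hxy.symm
  · rintro i z ⟨x, hx, rfl⟩
    exact e2' i x hx.2.1

open Filter Topology

def IsInv [MeasurableSpace X] (α : Γ →* X ≃ₜ X) (μ : Measure X) : Prop :=
  IsProbabilityMeasure μ ∧ μ.Regular ∧ ∀ γ : Γ, Measure.map ⇑(α γ) μ = μ

lemma integrable_cont [CompactSpace X] [T2Space X] [MeasurableSpace X] [BorelSpace X]
    (μ : Measure X) [IsFiniteMeasure μ] (φ : X → ℝ) (h : Continuous φ) : Integrable φ μ :=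
  h.integrable_of_hasCompactSupport (HasCompactSupport.of_compactSpace _)

lemma exists_limit [CompactSpace X] [T2Space X] [MeasurableSpace X] [BorelSpace X]
    (α : Γ →* X ≃ₜ X) (μ : ℕ → Measure X) (hμ : ∀ k, IsInv α (μ k)) :
    ∃ ν, IsInv α ν ∧ ∀ φ : C(X, ℝ), (∀ᶠ k in atTop, 0 ≤ ∫ x, φ x ∂μ k) → 0 ≤ ∫ x, φ x ∂ν := by
  have hp : ∀ k, IsProbabilityMeasure (μ k) := fun k => (hμ k).1
  have ex : ∀ φ : C(X, ℝ), ∃ l, Tendsto (fun k => ∫ x, φ x ∂μ k) (hyperfilter ℕ) (𝓝 l) := by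
    intro φ
    have hb : ∀ k, ∫ x, φ x ∂μ k ∈ Set.Icc (-‖φ‖) ‖φ‖ := by
      intro k
      rw [Set.mem_Icc, ← abs_le]
      have := norm_integral_le_of_norm_le_const (μ := μ k) (f := φ) (C := ‖φ‖)
        (ae_of_all _ fun x => φ.norm_coe_le_norm x)
      simpa using this
    obtain ⟨l, -, hl⟩ := isCompact_Icc.ultrafilter_le_nhds'
      ((hyperfilter ℕ).map (fun k => ∫ x, φ x ∂μ k))
      (by rw [Ultrafilter.mem_map]; exact Filter.univ_mem' hb)
    exact ⟨l, hl⟩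
  choose L hL using ex
  have Lnn : ∀ φ : C(X, ℝ), (∀ᶠ k in atTop, 0 ≤ ∫ x, φ x ∂μ k) → 0 ≤ L φ := by
    intro φ h
    refine ge_of_tendsto (hL φ) ?_
    have := h.filter_mono (Nat.hyperfilter_le_atTop)
    exact this
  let Λ : CompactlySupportedContinuousMap X ℝ →ₚ[ℝ] ℝ := PositiveLinearMap.mk₀
    { toFun := fun φ => L φ.toContinuousMap
      map_add' := by
        intro φ ψ
        refine tendsto_nhds_unique (hL _) ?_
        refine ((hL φ.toContinuousMap).add (hL ψ.toContinuousMap)).congr ?_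
        intro k
        rw [← integral_add]
        · rfl
        · exact integrable_cont _ _ φ.continuous
        · exact integrable_cont _ _ ψ.continuous
      map_smul' := by
        intro c φ
        refine tendsto_nhds_unique (hL _) ?_
        refine ((hL φ.toContinuousMap).const_mul c).congr ?_
        intro k
        rw [← integral_const_mul]
        rfl }
    (by
      intro φ hφ
      refine Lnn _ (Eventually.of_forall fun k => integral_nonneg fun x => hφ x))
  have hΛ : ∀ φ : C(X, ℝ), ∫ x, φ x ∂(RealRMK.rieszMeasure Λ) = L φ := by
    intro φ
    exact RealRMK.integral_rieszMeasure Λ ⟨φ, HasCompactSupport.of_compactSpace _⟩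
  have hreg : (RealRMK.rieszMeasure Λ).Regular := inferInstance
  refine ⟨RealRMK.rieszMeasure Λ, ⟨?_, inferInstance, ?_⟩, ?_⟩
  · have h1 := hΛ 1
    have h2 : L 1 = 1 := by
      refine tendsto_nhds_unique (hL _) ?_
      refine tendsto_const_nhds.congr ?_
      intro k; simp
    rw [h2] at h1
    constructor
    simp at h1
    rw [Measure.real, ENNReal.toReal_eq_one_iff] at h1
    exact h1
  · intro γ
    have : (Measure.map (α γ) (RealRMK.rieszMeasure Λ)).Regular := Measure.Regular.map (α γ)
    apply Measure.ext_of_integral_eq_on_compactlySupported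
    intro φ
    rw [integral_map (α γ).continuous.aemeasurable (map_continuous φ).aestronglyMeasurable]
    have h1 := hΛ (φ.toContinuousMap.comp ⟨α γ, (α γ).continuous⟩)
    have h2 := hΛ φ.toContinuousMap
    have h3 : L (φ.toContinuousMap.comp ⟨α γ, (α γ).continuous⟩) = L φ.toContinuousMap := by
      refine tendsto_nhds_unique (hL _) ((hL φ.toContinuousMap).congr ?_)
      intro k
      conv_lhs => rw [← (hμ k).2.2 γ]
      rw [integral_map (α γ).continuous.aemeasurable φ.continuous.aestronglyMeasurable]
      rfl
    exact h1.trans (h3.trans h2.symm)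
  · intro φ h
    rw [hΛ]
    exact Lnn φ h

/-- integral of an `ℕ`-valued function -/
noncomputable def I [MeasurableSpace X] (μ : Measure X) (f : C(X, ℕ)) : ℝ := ∫ x, (f x : ℝ) ∂μ

lemma cont_cast (f : C(X, ℕ)) : Continuous (fun x => (f x : ℝ)) :=
  continuous_of_discreteTopology.comp f.continuous

section meas
variable [CompactSpace X] [T2Space X] [MeasurableSpace X] [BorelSpace X]

lemma I_add (μ : Measure X) [IsFiniteMeasure μ] (f g : C(X, ℕ)) : I μ (f + g) = I μ f + I μ g := by
  unfold I
  rw [← integral_add (integrable_cont _ _ (cont_cast f)) (integrable_cont _ _ (cont_cast g))]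
  simp

lemma I_sum (μ : Measure X) [IsFiniteMeasure μ] {n : ℕ} (f : Fin n → C(X, ℕ)) :
    I μ (∑ i, f i) = ∑ i, I μ (f i) := by
  unfold I
  rw [← integral_finsetSum _ fun i _ => (integrable_cont _ _ (cont_cast (f i)))]
  simp [ContinuousMap.sum_apply]

lemma I_actC {α : Γ →* X ≃ₜ X} {μ : Measure X} (h : IsInv α μ) (γ : Γ) (f : C(X, ℕ)) :
    I μ (actC α γ f) = I μ f := by
  unfold I
  conv_rhs => rw [← h.2.2 γ⁻¹]
  rw [integral_map (α γ⁻¹).continuous.aemeasurable (cont_cast f).aestronglyMeasurable]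
  rfl

lemma I_rel {α : Γ →* X ≃ₜ X} {μ : Measure X} (h : IsInv α μ) {f g : C(X, ℕ)}
    (hfg : TypeRel α f g) : I μ f = I μ g := by
  obtain ⟨n, k, γ, rfl, rfl⟩ := hfg
  have := h.1
  simp only [I_sum, I_actC h]

lemma I_mono (μ : Measure X) [IsFiniteMeasure μ] {f g : C(X, ℕ)} (h : ∀ x, f x ≤ g x) :
    I μ f ≤ I μ g :=
  integral_mono (integrable_cont _ _ (cont_cast f)) (integrable_cont _ _ (cont_cast g))
    fun x => by simpa using h x

lemma I_nonneg (μ : Measure X) (f : C(X, ℕ)) : 0 ≤ I μ f := integral_nonneg fun x => by positivity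

lemma I_indC (μ : Measure X) [IsFiniteMeasure μ] (A : Set X) (hA : IsClopen A) :
    I μ (indC A hA) = μ.real A := by
  unfold I
  rw [← integral_indicator_one hA.2.measurableSet]
  congr 1
  classical
  ext x
  simp [indC_apply, Set.indicator_apply]

lemma I_nsmul (μ : Measure X) [IsFiniteMeasure μ] (n : ℕ) (f : C(X, ℕ)) :
    I μ (n • f) = n * I μ f := by
  unfold I
  rw [← integral_const_mul]
  simp

def supp (f : C(X, ℕ)) : Set X := {x | f x ≠ 0}

lemma supp_clopen (f : C(X, ℕ)) : IsClopen (supp f) :=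
    (isClopen_discrete {m : ℕ | m ≠ 0}).preimage f.continuous

lemma exists_bound (f : C(X, ℕ)) : ∃ N, 1 ≤ N ∧ ∀ x, f x ≤ N := by
  obtain ⟨N, hN⟩ := (isCompact_range f.continuous).bddAbove
  exact ⟨N + 1, by omega, fun x => (hN ⟨x, rfl⟩).trans (by omega)⟩

lemma I_le_supp (μ : Measure X) [IsFiniteMeasure μ] (f : C(X, ℕ)) (N : ℕ) (hN : ∀ x, f x ≤ N) :
    I μ f ≤ N * μ.real (supp f) := by
  rw [← I_indC μ _ (supp_clopen f), ← I_nsmul]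
  apply I_mono
  intro x
  classical
  simp only [ContinuousMap.coe_nsmul, Pi.smul_apply, indC_apply, supp, Set.mem_ofPred_eq]
  have := hN x
  split_ifs <;> simp_all

lemma supp_le_I (μ : Measure X) [IsFiniteMeasure μ] (f : C(X, ℕ)) : μ.real (supp f) ≤ I μ f := by
  rw [← I_indC μ _ (supp_clopen f)]
  apply I_mono
  intro x
  classical
  simp only [indC_apply, supp, Set.mem_ofPred_eq]
  split_ifs <;> omega

lemma isInv_restrict {α : Γ →* X ≃ₜ X} {μ : Measure X} (h : IsInv α μ) (E : Set X)
    (hE : MeasurableSet E) (hinv : ∀ γ, α γ ⁻¹' E = E) (hpos : μ E ≠ 0) :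
    IsInv α ((μ E)⁻¹ • μ.restrict E) := by
  have := h.1
  have := h.2.1
  refine ⟨⟨?_⟩, ?_, ?_⟩
  · simp [ENNReal.inv_mul_cancel hpos (measure_ne_top μ E)]
  · have : (μ.restrict E).Regular := Measure.Regular.restrict_of_measure_ne_top (measure_ne_top μ E)
    exact Measure.Regular.smul (ENNReal.inv_ne_top.2 hpos)
  · intro γ
    rw [Measure.map_smul]
    congr 1
    conv_rhs => rw [← h.2.2 γ]
    rw [Measure.restrict_map (α γ).continuous.measurable hE, hinv]
end meas

def gstep (α : Γ →* X ≃ₜ X) (γ : Γ) (p : C(X, ℕ) × C(X, ℕ)) : C(X, ℕ) × C(X, ℕ) :=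
  (csub p.1 (actC α γ⁻¹ p.2), csub p.2 (actC α γ p.1))

def gseq (α : Γ →* X ≃ₜ X) (e : ℕ → Γ) (f g : C(X, ℕ)) : ℕ → C(X, ℕ) × C(X, ℕ)
  | 0 => (f, g)
  | k + 1 => gstep α (e k) (gseq α e f g k)

lemma gstep_dec (α : Γ →* X ≃ₜ X) (γ : Γ) (p : C(X, ℕ) × C(X, ℕ)) :
    ∃ h, p.1 = (gstep α γ p).1 + h ∧ p.2 = (gstep α γ p).2 + actC α γ h := by
  refine ⟨cmin p.1 (actC α γ⁻¹ p.2), ?_, ?_⟩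
  · ext x; simp only [gstep, csub_apply, cmin_apply, actC_apply, ContinuousMap.add_apply, inv_inv]; omega
  · ext x
    simp only [gstep, csub_apply, cmin_apply, actC_apply, ContinuousMap.add_apply, inv_inv, act_act_inv]; omega

lemma gseq_tle (α : Γ →* X ≃ₜ X) (e : ℕ → Γ) (f g : C(X, ℕ)) (k : ℕ)
    (h : tle α (cls α (gseq α e f g k).1) (cls α (gseq α e f g k).2)) :
    tle α (cls α f) (cls α g) := by
  induction k with
  | zero => exact h
  | succ k ih =>
    apply ih
    obtain ⟨u, h1, h2⟩ := gstep_dec α (e k) (gseq α e f g k)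
    rw [h1, h2, cls_add, cls_add, cls_actC]
    exact tle_add h (tle_refl _ _)

lemma gseq_anti (α : Γ →* X ≃ₜ X) (e : ℕ → Γ) (f g : C(X, ℕ)) {k j : ℕ} (hkj : k ≤ j) (x : X) :
    (gseq α e f g j).1 x ≤ (gseq α e f g k).1 x ∧ (gseq α e f g j).2 x ≤ (gseq α e f g k).2 x := by
  induction hkj with
  | refl => exact ⟨le_rfl, le_rfl⟩
  | step _ ih =>
    refine ⟨le_trans ?_ ih.1, le_trans ?_ ih.2⟩ <;> simp [gseq, gstep]

lemma gseq_disj (α : Γ →* X ≃ₜ X) (e : ℕ → Γ) (f g : C(X, ℕ)) (k : ℕ) (x : X) :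
    (gseq α e f g (k + 1)).1 x = 0 ∨ (gseq α e f g (k + 1)).2 (α (e k) x) = 0 := by
  simp only [gseq, gstep, csub_apply, actC_apply, inv_inv, act_inv_act]
  omega

section meas2
variable [CompactSpace X] [T2Space X] [MeasurableSpace X] [BorelSpace X]

lemma gseq_I {α : Γ →* X ≃ₜ X} (e : ℕ → Γ) (f g : C(X, ℕ)) {μ : Measure X} (hμ : IsInv α μ)
    (k : ℕ) : I μ (gseq α e f g k).2 - I μ (gseq α e f g k).1 = I μ g - I μ f := by
  have := hμ.1
  induction k with
  | zero => rfl
  | succ k ih =>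
    obtain ⟨u, h1, h2⟩ := gstep_dec α (e k) (gseq α e f g k)
    rw [← ih, h1, h2, I_add, I_add, I_actC hμ]
    simp only [gseq]
    ring

lemma tendsto_I_zero (μ : Measure X) [IsFiniteMeasure μ] (u : ℕ → C(X, ℕ))
    (hu : ∀ k j, k ≤ j → ∀ x, u j x ≤ u k x) (h0 : μ (⋂ k, supp (u k)) = 0) :
    Tendsto (fun k => I μ (u k)) atTop (𝓝 0) := by
  obtain ⟨N, -, hN⟩ := exists_bound (u 0)
  have h1 : Tendsto (fun k => μ (supp (u k))) atTop (𝓝 (μ (⋂ k, supp (u k)))) := by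
    apply tendsto_measure_iInter_atTop
    · exact fun k => (supp_clopen (u k)).2.measurableSet.nullMeasurableSet
    · intro k j hkj x hx
      have := hu k j hkj x
      simp only [supp, Set.mem_ofPred_eq] at hx ⊢
      omega
    · exact ⟨0, measure_ne_top _ _⟩
  rw [h0] at h1
  have h2 : Tendsto (fun k => (N : ℝ) * μ.real (supp (u k))) atTop (𝓝 0) := by
    have := ((ENNReal.tendsto_toReal ENNReal.zero_ne_top).comp h1).const_mul (N : ℝ)
    simpa [Measure.real] using this
  exact squeeze_zero (fun k => I_nonneg _ _)
    (fun k => I_le_supp μ _ N fun x => (hu 0 k (Nat.zero_le _) x).trans (hN x)) h2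

lemma gseq_tendsto {α : Γ →* X ≃ₜ X} (e : ℕ → Γ) (he : Function.Surjective e) (f g : C(X, ℕ))
    (hfg : ∀ μ : Measure X, IsInv α μ → I μ f < I μ g) {μ : Measure X} (hμ : IsInv α μ) :
    Tendsto (fun k => I μ (gseq α e f g k).1) atTop (𝓝 0) := by
  have := hμ.1
  apply tendsto_I_zero
  · exact fun k j hkj x => (gseq_anti α e f g hkj x).1
  set F := ⋂ k, supp (gseq α e f g k).1 with hF
  have hFm : MeasurableSet F := MeasurableSet.iInter fun k => (supp_clopen _).2.measurableSet
  by_contra hne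
  set E := ⋃ k, (α (e k)) ⁻¹' F with hE
  have hEm : MeasurableSet E :=
    MeasurableSet.iUnion fun k => (α (e k)).continuous.measurable hFm
  have hmem : ∀ x, x ∈ E ↔ ∃ γ, α γ x ∈ F := by
    intro x
    simp only [hE, Set.mem_iUnion, Set.mem_preimage]
    exact ⟨fun ⟨k, hk⟩ => ⟨_, hk⟩, fun ⟨γ, hγ⟩ => by
      obtain ⟨k, rfl⟩ := he γ
      exact ⟨k, hγ⟩⟩
  have hinv : ∀ γ, α γ ⁻¹' E = E := by
    intro γ
    ext x
    rw [Set.mem_preimage, hmem, hmem]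
    constructor
    · rintro ⟨δ, h⟩
      exact ⟨δ * γ, by rwa [act_mul]⟩
    · rintro ⟨δ, h⟩
      exact ⟨δ * γ⁻¹, by rwa [act_mul, act_inv_act]⟩
  have hFE : F ⊆ E := fun x hx => (hmem x).2 ⟨1, by rwa [act_one]⟩
  have hpos : μ E ≠ 0 := fun h => hne (measure_mono_null hFE h)
  have hν := isInv_restrict hμ E hEm hinv hpos
  set ν := (μ E)⁻¹ • μ.restrict E with hνdef
  have := hν.1
  have ht : Tendsto (fun k => I ν (gseq α e f g k).2) atTop (𝓝 0) := by
    apply tendsto_I_zero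
    · exact fun k j hkj x => (gseq_anti α e f g hkj x).2
    · have hG : MeasurableSet (⋂ k, supp (gseq α e f g k).2) :=
        MeasurableSet.iInter fun k => (supp_clopen _).2.measurableSet
      rw [hνdef, Measure.smul_apply, Measure.restrict_apply hG]
      have : (⋂ k, supp (gseq α e f g k).2) ∩ E = ∅ := by
        rw [Set.eq_empty_iff_forall_notMem]
        rintro x ⟨hx, hxE⟩
        obtain ⟨γ, hγ⟩ := (hmem x).1 hxE
        obtain ⟨k, hk⟩ := he γ⁻¹
        rcases gseq_disj α e f g k (α γ x) with h | h
        · exact (Set.mem_iInter.1 hγ (k + 1)) h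
        · rw [hk, act_inv_act] at h
          exact (Set.mem_iInter.1 hx (k + 1)) h
      rw [this]; simp
  have hlt := hfg ν hν
  have hge : I ν g - I ν f ≤ 0 := by
    refine ge_of_tendsto' ht fun k => ?_
    have := gseq_I e f g hν k
    have := I_nonneg ν (gseq α e f g k).1
    linarith
  linarith

lemma exists_k {α : Γ →* X ≃ₜ X} (e : ℕ → Γ) (he : Function.Surjective e) (f g : C(X, ℕ))
    (hfg : ∀ μ : Measure X, IsInv α μ → I μ f < I μ g) (K : ℕ) :
    ∃ k, ∀ μ : Measure X, IsInv α μ → K * I μ (gseq α e f g k).1 < I μ (gseq α e f g k).2 := by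
  by_contra hcon
  push Not at hcon
  choose μ hμ hle using hcon
  obtain ⟨ν, hν, hlim⟩ := exists_limit α μ hμ
  have := hν.1
  have key : ∀ j, I ν g ≤ I ν f + K * I ν (gseq α e f g j).1 := by
    intro j
    have h := hlim ⟨fun x => (f x : ℝ) + K * ((gseq α e f g j).1 x : ℝ) - (g x : ℝ),
      ((cont_cast f).add ((cont_cast _).const_mul _)).sub (cont_cast g)⟩ ?_
    · simp only [ContinuousMap.coe_mk] at h
      rw [integral_sub, integral_add, integral_const_mul] at h
      · unfold I; linarith
      all_goals apply integrable_cont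
      · exact cont_cast f
      · exact (cont_cast _).const_mul _
      · exact (cont_cast f).add ((cont_cast _).const_mul _)
      · exact cont_cast g
    · filter_upwards [eventually_ge_atTop j] with k hk
      have := (hμ k).1
      simp only [ContinuousMap.coe_mk]
      rw [integral_sub, integral_add, integral_const_mul]
      · have h1 := hle k
        have h2 := gseq_I e f g (hμ k) k
        have h3 := I_nonneg (μ k) (gseq α e f g k).1
        have h4 : I (μ k) (gseq α e f g k).1 ≤ I (μ k) (gseq α e f g j).1 :=
          I_mono _ fun x => (gseq_anti α e f g hk x).1
        have h5 := mul_le_mul_of_nonneg_left h4 (Nat.cast_nonneg (α := ℝ) K)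
        unfold I at *
        linarith
      all_goals apply integrable_cont
      · exact cont_cast f
      · exact (cont_cast _).const_mul _
      · exact (cont_cast f).add ((cont_cast _).const_mul _)
      · exact cont_cast g
  have ht := gseq_tendsto e he f g hfg hν
  have hle : I ν g ≤ I ν f + K * 0 :=
    ge_of_tendsto' ((ht.const_mul (K : ℝ)).const_add (I ν f)) key
  have := hfg ν hν
  linarith

/-- comparison, generic measurable space -/
def DC (α : Γ →* X ≃ₜ X) : Prop :=
  ∀ A B : Set X, IsClopen A → IsClopen B → B.Nonempty →
    (∀ μ : Measure X, IsInv α μ → μ A < μ B) → Subequidecomposable α A B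

lemma multi {α : Γ →* X ≃ₜ X} (hdc : DC α) {μ₀ : Measure X} (hμ₀ : IsInv α μ₀)
    (A : Set X) (hA : IsClopen A) (N : ℕ) : ∀ (B : Set X) (hB : IsClopen B),
    (∀ μ : Measure X, IsInv α μ → N * μ.real A < μ.real B) →
    tle α (N • cls α (indC A hA)) (cls α (indC B hB)) := by
  induction N with
  | zero => intro B hB _; exact ⟨cls α (indC B hB), by simp⟩
  | succ N ih =>
    intro B hB h
    have hlt : ∀ μ : Measure X, IsInv α μ → μ.real A < μ.real B := by
      intro μ hμ
      have h1 := h μ hμ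
      have h2 : 0 ≤ N * μ.real A := by positivity
      push_cast at h1
      linarith
    have hne : B.Nonempty := by
      rw [Set.nonempty_iff_ne_empty]
      rintro rfl
      have h1 := hlt μ₀ hμ₀
      simp only [measureReal_empty] at h1
      linarith [measureReal_nonneg (μ := μ₀) (s := A)]
    obtain ⟨C, hC, hCB, hrel⟩ := subeq_copy hA (hdc A B hA hB hne (by
      intro μ hμ
      have := hμ.1
      exact (ENNReal.toReal_lt_toReal (measure_ne_top _ _) (measure_ne_top _ _)).1 (hlt μ hμ)))
    have hih := ih (B \ C) (hB.diff hC) (by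
      intro μ hμ
      have := hμ.1
      rw [measureReal_sdiff hCB hC.2.measurableSet]
      have e := I_rel hμ hrel
      rw [I_indC, I_indC] at e
      have := h μ hμ
      push_cast at this
      linarith)
    have hsum : cls α (indC B hB) = cls α (indC (B \ C) (hB.diff hC)) + cls α (indC A hA) := by
      rw [(cls_eq_iff α _ _).2 hrel, ← cls_add]
      congr 1
      classical
      ext x
      simp only [ContinuousMap.add_apply, indC_apply, Set.mem_sdiff]
      by_cases hx : x ∈ C
      · simp [hx, hCB hx]
      · simp [hx]
    rw [hsum, succ_nsmul]
    exact tle_add hih (tle_refl _ _)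

lemma main_nonempty [Countable Γ] {α : Γ →* X ≃ₜ X} (hdc : DC α) {μ₀ : Measure X}
    (hμ₀ : IsInv α μ₀) (f g : C(X, ℕ))
    (hfg : ∀ μ : Measure X, IsInv α μ → I μ f < I μ g) : tle α (cls α f) (cls α g) := by
  obtain ⟨e, he⟩ := exists_surjective_nat Γ
  obtain ⟨N, hN1, hN⟩ := exists_bound f
  obtain ⟨m, hm1, hm⟩ := exists_bound g
  obtain ⟨k, hk⟩ := exists_k e he f g hfg (N * m)
  apply gseq_tle α e f g k
  have hN' : ∀ x, (gseq α e f g k).1 x ≤ N := fun x =>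
    (gseq_anti α e f g (Nat.zero_le k) x).1.trans (hN x)
  have hm' : ∀ x, (gseq α e f g k).2 x ≤ m := fun x =>
    (gseq_anti α e f g (Nat.zero_le k) x).2.trans (hm x)
  have key := multi hdc hμ₀ (supp (gseq α e f g k).1) (supp_clopen _) N
    (supp (gseq α e f g k).2) (supp_clopen _) (by
      intro μ hμ
      have := hμ.1
      have h1 := hk μ hμ
      have h2 := I_le_supp μ _ m hm'
      have h3 := supp_le_I μ (gseq α e f g k).1
      have hm0 : (0 : ℝ) < m := by exact_mod_cast hm1
      have h4 := mul_le_mul_of_nonneg_left h3 (by positivity : (0 : ℝ) ≤ N * m)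
      push_cast at h1
      refine lt_of_mul_lt_mul_left ?_ hm0.le
      nlinarith)
  refine tle_trans ?_ (tle_trans key ?_)
  · rw [← cls_nsmul]
    apply tle_of_le
    intro x
    have := hN' x
    classical
    simp only [ContinuousMap.coe_nsmul, Pi.smul_apply, indC_apply, supp, Set.mem_ofPred_eq]
    split_ifs <;> simp_all
  · apply tle_of_le
    intro x
    classical
    simp only [indC_apply, supp, Set.mem_ofPred_eq]
    split_ifs <;> omega

lemma DC_tle {α : Γ →* X ≃ₜ X} (hdc : DC α) (hem : ∀ μ : Measure X, ¬ IsInv α μ)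
    (A B : Set X) (hA : IsClopen A) (hB : IsClopen B) (hne : B.Nonempty) :
    tle α (cls α (indC A hA)) (cls α (indC B hB)) := by
  obtain ⟨C, hC, hCB, hrel⟩ := subeq_copy hA (hdc A B hA hB hne fun μ hμ => absurd hμ (hem μ))
  rw [(cls_eq_iff α _ _).2 hrel]
  apply tle_of_le
  intro x
  classical
  simp only [indC_apply]
  by_cases hx : x ∈ C
  · simp [hx, hCB hx]
  · simp [hx]

lemma main_empty [TotallyDisconnectedSpace X] [Nonempty X] {α : Γ →* X ≃ₜ X} (hdc : DC α)
    (hem : ∀ μ : Measure X, ¬ IsInv α μ) (f g : C(X, ℕ)) (hg : g ≠ 0) :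
    tle α (cls α f) (cls α g) := by
  have hnt : ∃ x y : X, x ≠ y := by
    by_contra hcon
    push Not at hcon
    obtain ⟨x⟩ := ‹Nonempty X›
    have : Subsingleton X := ⟨hcon⟩
    have : Finite X := inferInstance
    have : DiscreteTopology X := inferInstance
    refine hem (Measure.dirac x) ⟨inferInstance, inferInstance, fun γ => ?_⟩
    rw [Measure.map_dirac' (α γ).continuous.measurable]
    rw [hcon (α γ x) x]
  obtain ⟨x, y, hxy⟩ := hnt
  obtain ⟨U, hU, hxU, hyU⟩ := exists_isClopen_of_totally_separated hxy
  have h2 : tle α (cls α (indC Set.univ isClopen_univ) + cls α (indC Set.univ isClopen_univ))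
      (cls α (indC Set.univ isClopen_univ)) := by
    have h3 := tle_add (DC_tle hdc hem Set.univ U isClopen_univ hU ⟨x, hxU⟩)
      (DC_tle hdc hem Set.univ Uᶜ isClopen_univ hU.compl ⟨y, hyU⟩)
    refine tle_trans h3 ?_
    rw [← cls_add]
    apply tle_of_le
    intro z
    classical
    simp only [ContinuousMap.add_apply, indC_apply]
    by_cases hz : z ∈ U <;> simp [hz]
  have hN : ∀ N : ℕ, tle α (N • cls α (indC (Set.univ : Set X) isClopen_univ))
      (cls α (indC Set.univ isClopen_univ)) := by
    intro N
    induction N with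
    | zero => exact ⟨_, by rw [zero_nsmul, zero_add]⟩
    | succ N ih =>
      rw [succ_nsmul]
      exact tle_trans (tle_add ih (tle_refl _ _)) h2
  obtain ⟨N, -, hfN⟩ := exists_bound f
  have hgne : (supp g).Nonempty := by
    by_contra hcon
    apply hg
    ext z
    by_contra hz
    exact hcon ⟨z, hz⟩
  refine tle_trans ?_ (tle_trans (hN N) (tle_trans
    (DC_tle hdc hem Set.univ (supp g) isClopen_univ (supp_clopen g) hgne) ?_))
  · rw [← cls_nsmul]
    apply tle_of_le
    intro x
    classical
    simpa [indC_apply] using hfN x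
  · apply tle_of_le
    intro x
    classical
    simp only [indC_apply, supp, Set.mem_ofPred_eq]
    split_ifs <;> omega

lemma main_gen [Countable Γ] [TotallyDisconnectedSpace X] [Nonempty X] (α : Γ →* X ≃ₜ X) :
    DC α ↔ ∀ f g : C(X, ℕ), cls α f ≠ 0 → cls α g ≠ 0 →
      (∀ μ : Measure X, IsInv α μ → I μ f < I μ g) → tle α (cls α f) (cls α g) := by
  constructor
  · intro hdc f g _ hg hfg
    by_cases hem : ∃ μ : Measure X, IsInv α μ
    · obtain ⟨μ₀, hμ₀⟩ := hem
      exact main_nonempty hdc hμ₀ f g hfg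
    · push Not at hem
      exact main_empty hdc hem f g (by rintro rfl; exact hg rfl)
  · intro h A B hA hB hne hAB
    apply subeq_of_tle hA hB
    have hnz : ∀ (D : Set X) (hD : IsClopen D), D.Nonempty → cls α (indC D hD) ≠ 0 := by
      rintro D hD ⟨x, hx⟩
      apply cls_ne_zero
      intro h0
      classical
      have := congrArg (fun u : C(X, ℕ) => u x) h0
      simp [indC_apply, hx] at this
    by_cases hAe : A.Nonempty
    · apply h _ _ (hnz A hA hAe) (hnz B hB hne)
      intro μ hμ
      have := hμ.1
      rw [I_indC, I_indC]
      exact (ENNReal.toReal_lt_toReal (measure_ne_top _ _) (measure_ne_top _ _)).2 (hAB μ hμ)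
    · apply tle_of_le
      intro x
      classical
      have : x ∉ A := fun hx => hAe ⟨x, hx⟩
      simp [indC_apply, this]
end meas2

end Aux

/-- Let `α` be an action of a countable group `Γ` by homeomorphisms on a
nonempty compact Hausdorff `0`-dimensional space `X`. Then `α` has dynamical comparison iff
for all nonzero `a = [f]`, `b = [g]` in `T(α)` with `μ(a) < μ(b)` for every `μ ∈ M(α)`, one
has `a ≤ b`. -/
theorem stmt8 {Γ : Type*} [Group Γ] [Countable Γ]
    {X : Type*} [TopologicalSpace X] [CompactSpace X] [T2Space X]
    [TotallyDisconnectedSpace X] [Nonempty X]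
    (α : Γ →* (X ≃ₜ X)) :
    DynComparison α ↔
      ∀ f g : C(X, ℕ), cls α f ≠ 0 → cls α g ≠ 0 →
        (∀ μ ∈ invRadon α, intOf μ f < intOf μ g) → tle α (cls α f) (cls α g) := by
  letI : MeasurableSpace X := borel X
  haveI : BorelSpace X := ⟨rfl⟩
  exact main_gen α
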